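/- arXiv:1605.03653 — 2 statements merged into one kernel-verified Lean document; each statement's English description precedes it below -/
import Mathlib

section
/- Fix κ ∈ (0,1), q ∈ [0,1], w > 0, and a finite Borel measure μ on [0,1] having a continuous, everywhere positive density with respect to Lebesgue measure. Let (f,a) be a feasible strategy profile with d₁ > 0 and d₂ > 0, and suppose q > d₁/(κ(d₁+d₂)). Then a₁·(κq/P^{f,a} − 1) + a₂·(κ(1−q)/(1−P^{f,a}) − 1) = sup over b₁,b₂ ≥ 0 with b₁+b₂ ≤ w of [b₁·(κq(d₁+d₂+b₁+b₂)/(d₁+b₁) − 1) + b₂·(κ(1−q)(d₁+d₂+b₁+b₂)/(d₂+b₂) − 1)] holds if and only if a₂ = 0 and a₁ = min{w, √(κ·q·d₁·d₂/(1−κq)) − d₁}. -/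
open MeasureTheory Set

noncomputable section

/-- `μ` is a finite Borel measure on `[0,1]` with a continuous, everywhere positive
density with respect to Lebesgue measure. -/
def NiceDensity (μ : Measure ℝ) : Prop :=
  ∃ g : ℝ → ℝ, ContinuousOn g (Icc 0 1) ∧ (∀ p ∈ Icc (0:ℝ) 1, 0 < g p) ∧
    μ = (volume.restrict (Icc (0:ℝ) 1)).withDensity (fun p => ENNReal.ofReal (g p))

/-- Total amount wagered by the diffuse players on Outcome 1. -/
def d1 (μ : Measure ℝ) (f : ℝ → ℝ × ℝ) : ℝ := ∫ p in Icc (0:ℝ) 1, (f p).1 ∂μ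

/-- Total amount wagered by the diffuse players on Outcome 2. -/
def d2 (μ : Measure ℝ) (f : ℝ → ℝ × ℝ) : ℝ := ∫ p in Icc (0:ℝ) 1, (f p).2 ∂μ

/-- The implied probability of Outcome 1, `P^{f,a}`. -/
def impliedProb (μ : Measure ℝ) (f : ℝ → ℝ × ℝ) (a : ℝ × ℝ) : ℝ :=
  (d1 μ f + a.1) / (d1 μ f + d2 μ f + a.1 + a.2)

/-- A feasible strategy profile for the diffuse players. -/
def FeasibleDiffuse (f : ℝ → ℝ × ℝ) : Prop :=
  Measurable f ∧ ∀ p ∈ Icc (0:ℝ) 1, 0 ≤ (f p).1 ∧ 0 ≤ (f p).2 ∧ (f p).1 + (f p).2 ≤ 1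

/-- A feasible strategy profile for the atomic player. -/
def FeasibleAtomic (w : ℝ) (a : ℝ × ℝ) : Prop := 0 ≤ a.1 ∧ 0 ≤ a.2 ∧ a.1 + a.2 ≤ w

/-- Payoff of the atomic player. -/
def payoff (k q x y b1 b2 : ℝ) : ℝ :=
  b1 * (k * q * (x + y + b1 + b2) / (x + b1) - 1) +
    b2 * (k * (1 - q) * (x + y + b1 + b2) / (y + b2) - 1)

theorem payoff_eq (k q x y b1 b2 : ℝ) (h1 : 0 < x + b1) (h2 : 0 < y + b2) :
    payoff k q x y b1 b2 = (k - 1) * ((x + b1) + (y + b2)) - k * (q * x + (1 - q) * y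
      + q * x * ((y + b2) / (x + b1)) + (1 - q) * y * ((x + b1) / (y + b2))) + x + y := by
  unfold payoff
  field_simp
  ring

theorem payoff_one (k q x y S b : ℝ) (hx : 0 < x) (hb : 0 ≤ b)
    (hS : (1 - k * q) * S ^ 2 = k * q * x * y) :
    payoff k q x y b 0 = x + k * q * (y - x)
      - (1 - k * q) * ((x + b) + S ^ 2 / (x + b)) := by
  have h1 : 0 < x + b := by linarith
  have : (1 - k * q) * ((x + b) + S ^ 2 / (x + b))
      = (1 - k * q) * (x + b) + k * q * x * y / (x + b) := by
    rw [← hS]; ring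
  rw [this]
  unfold payoff
  field_simp
  ring

theorem one_dim (k q x y S w b : ℝ) (hx : 0 < x) (hc : 0 < 1 - k * q) (hxS : x < S)
    (hS : (1 - k * q) * S ^ 2 = k * q * x * y) (hw : 0 < w) (hb : 0 ≤ b) (hbw : b ≤ w)
    (hne : b ≠ min w (S - x)) :
    payoff k q x y b 0 < payoff k q x y (min w (S - x)) 0 := by
  have hm : 0 < min w (S - x) := lt_min hw (by linarith)
  rw [payoff_one k q x y S b hx hb hS, payoff_one k q x y S _ hx hm.le hS]
  set m := min w (S - x) with hmdef
  have h1 : 0 < x + b := by linarith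
  have h2 : 0 < x + m := by linarith
  have key : ((x + b) + S ^ 2 / (x + b)) - ((x + m) + S ^ 2 / (x + m))
      = (b - m) * ((x + b) * (x + m) - S ^ 2) / ((x + b) * (x + m)) := by
    field_simp
    ring
  have hpos : 0 < (b - m) * ((x + b) * (x + m) - S ^ 2) := by
    rcases le_total w (S - x) with h | h
    · have hmw : m = w := min_eq_left h
      have hlt : b < m := lt_of_le_of_ne (hmw ▸ hbw) hne
      have : (x + b) * (x + m) < S ^ 2 := by
        have : x + m ≤ S := by linarith
        nlinarith
      nlinarith
    · have hmw : m = S - x := min_eq_right h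
      have h3 : 0 < (b - m) ^ 2 := by
        have := sub_ne_zero.mpr hne
        positivity
      have h4 : (b - m) * ((x + b) * (x + m) - S ^ 2) = S * (b - m) ^ 2 := by
        rw [hmw]; ring
      rw [h4]
      have : 0 < S := by linarith
      positivity
  have h5 := div_pos hpos (mul_pos h1 h2)
  rw [← key] at h5
  nlinarith

theorem main_lt (k q x y S w b1 b2 : ℝ) (hx : 0 < x) (hy : 0 < y) (hk1 : k < 1)
    (hc : 0 < 1 - k * q) (hxS : x < S) (hprof : x < k * q * (x + y))
    (hS : (1 - k * q) * S ^ 2 = k * q * x * y) (hw : 0 < w)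
    (hb1 : 0 ≤ b1) (hb2 : 0 ≤ b2) (hbw : b1 + b2 ≤ w)
    (hne : ¬ (b2 = 0 ∧ b1 = min w (S - x))) :
    payoff k q x y b1 b2 < payoff k q x y (min w (S - x)) 0 := by
  rcases hb2.eq_or_lt with h0 | h0
  · subst h0
    exact one_dim k q x y S w b1 hx hc hxS hS hw hb1 (by linarith) (fun h => hne ⟨rfl, h⟩)
  have hX : 0 < x + b1 := by linarith
  have hY : 0 < y + b2 := by linarith
  have hm : 0 < min w (S - x) := lt_min hw (by linarith)
  have le_of : ∀ b, 0 ≤ b → b ≤ w → payoff k q x y b 0 ≤ payoff k q x y (min w (S - x)) 0 := by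
    intro b hb hbw
    by_cases h : b = min w (S - x)
    · rw [← h]
    · exact (one_dim k q x y S w b hx hc hxS hS hw hb hbw h).le
  rcases le_total ((y + b2) * x) (y * (x + b1)) with h | h
  · set b := y * (x + b1) / (y + b2) - x with hbdef
    have hxb : x + b = y * (x + b1) / (y + b2) := by rw [hbdef]; ring
    have hb : 0 ≤ b := by
      rw [hbdef, sub_nonneg, le_div_iff₀ hY]; linarith
    have hbb1 : b ≤ b1 := by
      have : y * (x + b1) / (y + b2) ≤ x + b1 := by
        rw [div_le_iff₀ hY]; nlinarith
      linarith
    refine lt_of_lt_of_le ?_ (le_of b hb (by linarith))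
    rw [payoff_eq k q x y b1 b2 hX hY, payoff_eq k q x y b 0 (by linarith) (by linarith)]
    have r1 : (y + 0) / (x + b) = (y + b2) / (x + b1) := by
      rw [hxb]; field_simp; ring
    have r2 : (x + b) / (y + 0) = (x + b1) / (y + b2) := by
      rw [hxb]; field_simp; ring
    rw [r1, r2]
    nlinarith
  · set b := x * (y + b2) / (x + b1) - y with hbdef
    have hxb : y + b = x * (y + b2) / (x + b1) := by rw [hbdef]; ring
    have hb : 0 ≤ b := by
      rw [hbdef, sub_nonneg, le_div_iff₀ hX]; linarith
    have hbb2 : b ≤ b2 := by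
      have : x * (y + b2) / (x + b1) ≤ y + b2 := by
        rw [div_le_iff₀ hX]; nlinarith
      linarith
    have s1 : payoff k q x y b1 b2 ≤ payoff k q x y 0 b := by
      rw [payoff_eq k q x y b1 b2 hX hY, payoff_eq k q x y 0 b (by linarith) (by linarith)]
      have r1 : (y + b) / (x + 0) = (y + b2) / (x + b1) := by
        rw [hxb]; field_simp; ring
      have r2 : (x + 0) / (y + b) = (x + b1) / (y + b2) := by
        rw [hxb]; field_simp; ring
      rw [r1, r2]
      nlinarith
    have s2 : payoff k q x y 0 b ≤ 0 := by
      have hyb : 0 < y + b := by linarith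
      have : k * (1 - q) * (x + y + 0 + b) / (y + b) ≤ 1 := by
        rw [div_le_one hyb]
        have e1 : k * (1 - q) * (x + y) < y := by nlinarith
        have e2 : k * (1 - q) < 1 := by
          by_contra hcon
          push Not at hcon
          nlinarith
        nlinarith
      unfold payoff
      nlinarith
    have s3 : payoff k q x y 0 0 = 0 := by simp [payoff]
    have s4 := one_dim k q x y S w 0 hx hc hxS hS hw le_rfl hw.le hm.ne
    linarith

/-- Proposition 2(i): the atomic player's optimal wager when betting on Outcome 1
is profitable. -/
theorem stmt_1 (κ q w : ℝ) (hκ : κ ∈ Ioo (0:ℝ) 1) (hq : q ∈ Icc (0:ℝ) 1) (hw : 0 < w)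
    (μ : Measure ℝ) (hμ : NiceDensity μ)
    (f : ℝ → ℝ × ℝ) (a : ℝ × ℝ) (hf : FeasibleDiffuse f) (ha : FeasibleAtomic w a)
    (hd1 : 0 < d1 μ f) (hd2 : 0 < d2 μ f)
    (hq1 : q > d1 μ f / (κ * (d1 μ f + d2 μ f))) :
    (a.1 * (κ * q / impliedProb μ f a - 1) +
        a.2 * (κ * (1 - q) / (1 - impliedProb μ f a) - 1) =
      sSup {x | ∃ b1 b2 : ℝ, 0 ≤ b1 ∧ 0 ≤ b2 ∧ b1 + b2 ≤ w ∧
        x = b1 * (κ * q * (d1 μ f + d2 μ f + b1 + b2) / (d1 μ f + b1) - 1) +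
          b2 * (κ * (1 - q) * (d1 μ f + d2 μ f + b1 + b2) / (d2 μ f + b2) - 1)})
    ↔ (a.2 = 0 ∧
        a.1 = min w (Real.sqrt (κ * q * d1 μ f * d2 μ f / (1 - κ * q)) - d1 μ f)) := by
  obtain ⟨hk0, hk1⟩ := hκ
  obtain ⟨hq0, hq2⟩ := hq
  obtain ⟨ha1, ha2, haw⟩ := ha
  unfold impliedProb
  generalize d1 μ f = x at *
  generalize d2 μ f = y at *
  have hprof : x < κ * q * (x + y) := by
    rw [gt_iff_lt, div_lt_iff₀ (by positivity)] at hq1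
    linarith
  have hc : 0 < 1 - κ * q := by nlinarith
  have hnn : 0 ≤ κ * q * x * y / (1 - κ * q) := by positivity
  set S := Real.sqrt (κ * q * x * y / (1 - κ * q)) with hSdef
  have hS : (1 - κ * q) * S ^ 2 = κ * q * x * y := by
    rw [hSdef, Real.sq_sqrt hnn]; field_simp
  have hxS : x < S := by
    apply Real.lt_sqrt_of_sq_lt
    rw [lt_div_iff₀ hc]
    nlinarith
  have hlt := fun b1 b2 => main_lt κ q x y S w b1 b2 hd1 hd2 hk1 hc hxS hprof hS hw
  have hm : 0 < min w (S - x) := lt_min hw (by linarith)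
  have hgr : IsGreatest {z | ∃ b1 b2 : ℝ, 0 ≤ b1 ∧ 0 ≤ b2 ∧ b1 + b2 ≤ w ∧
        z = b1 * (κ * q * (x + y + b1 + b2) / (x + b1) - 1) +
          b2 * (κ * (1 - q) * (x + y + b1 + b2) / (y + b2) - 1)}
        (payoff κ q x y (min w (S - x)) 0) := by
    constructor
    · exact ⟨min w (S - x), 0, hm.le, le_rfl, by rw [add_zero]; exact min_le_left _ _, rfl⟩
    · rintro z ⟨b1, b2, h1, h2, h3, rfl⟩
      change payoff κ q x y b1 b2 ≤ _
      by_cases h : b2 = 0 ∧ b1 = min w (S - x)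
      · rw [h.1, h.2]
      · exact (hlt b1 b2 h1 h2 h3 h).le
  rw [hgr.csSup_eq]
  have hX : 0 < x + a.1 := by linarith
  have hY : 0 < y + a.2 := by linarith
  have hT : 0 < x + y + a.1 + a.2 := by linarith
  have hP : 1 - (x + a.1) / (x + y + a.1 + a.2) = (y + a.2) / (x + y + a.1 + a.2) := by
    field_simp; ring
  have hL : a.1 * (κ * q / ((x + a.1) / (x + y + a.1 + a.2)) - 1) +
      a.2 * (κ * (1 - q) / (1 - (x + a.1) / (x + y + a.1 + a.2)) - 1)
      = payoff κ q x y a.1 a.2 := by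
    rw [hP, div_div_eq_mul_div, div_div_eq_mul_div]; rfl
  rw [hL]
  constructor
  · intro h
    by_contra hcon
    exact (hlt a.1 a.2 ha1 ha2 haw hcon).ne h
  · rintro ⟨h1, h2⟩
    rw [h1, h2]
end
end

section
/- Fix κ ∈ (0,1), q ∈ [0,1], w > 0, and a finite Borel measure μ on [0,1] having a continuous, everywhere positive density with respect to Lebesgue measure. Let (f,a) be a feasible strategy profile with d₁ > 0 and d₂ > 0, and suppose q ≤ d₁/(κ(d₁+d₂)) and 1−q ≤ d₂/(κ(d₁+d₂)). Then a₁·(κq/P^{f,a} − 1) + a₂·(κ(1−q)/(1−P^{f,a}) − 1) = sup over b₁,b₂ ≥ 0 with b₁+b₂ ≤ w of [b₁·(κq(d₁+d₂+b₁+b₂)/(d₁+b₁) − 1) + b₂·(κ(1−q)(d₁+d₂+b₁+b₂)/(d₂+b₂) − 1)] holds if and only if a₁ = 0 and a₂ = 0. -/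
open MeasureTheory Set

noncomputable section

/-- The case where Outcome 1 looks favourable after the bets. -/
lemma num_neg_of_pos {α β D E x y : ℝ} (hD : 0 < D) (hE : 0 < E) (hs : α + β < 1)
    (h1 : α * (D + E) ≤ D) (hx : 0 ≤ x) (hy : 0 ≤ y)
    (hpos : 0 < α * (D + E + x + y) - (D + x)) :
    x * (α * (D + E + x + y) - (D + x)) * (E + y)
      + y * (β * (D + E + x + y) - (E + y)) * (D + x) < 0 := by
  have hb : x < α * (x + y) := by nlinarith
  have hk : x * E - y * D < 0 := by
    have e1 : x * (D + E) < α * (x + y) * (D + E) :=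
      mul_lt_mul_of_pos_right hb (by linarith)
    have e2 : α * (D + E) * (x + y) ≤ D * (x + y) :=
      mul_le_mul_of_nonneg_right h1 (by linarith)
    nlinarith
  have hT : 0 < D + E + x + y := by linarith
  have h3 : β * (D + E + x + y) - (E + y) ≤ -(α * (D + E + x + y) - (D + x)) := by
    nlinarith [mul_pos (sub_pos.2 hs) hT]
  have h4 : y * (D + x) * (β * (D + E + x + y) - (E + y))
      ≤ y * (D + x) * -(α * (D + E + x + y) - (D + x)) :=
    mul_le_mul_of_nonneg_left h3 (by positivity)
  have h5 := mul_neg_of_pos_of_neg hpos hk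
  nlinarith

lemma num_neg {α β D E x y : ℝ} (hD : 0 < D) (hE : 0 < E) (hs : α + β < 1)
    (hα : 0 ≤ α) (hβ : 0 ≤ β)
    (h1 : α * (D + E) ≤ D) (h2 : β * (D + E) ≤ E) (hx : 0 ≤ x) (hy : 0 ≤ y)
    (hxy : 0 < x + y) :
    x * (α * (D + E + x + y) - (D + x)) * (E + y)
      + y * (β * (D + E + x + y) - (E + y)) * (D + x) < 0 := by
  rcases lt_or_ge 0 (α * (D + E + x + y) - (D + x)) with hp | hA
  · exact num_neg_of_pos hD hE hs h1 hx hy hp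
  rcases lt_or_ge 0 (β * (D + E + x + y) - (E + y)) with hp | hB
  · have e : E + D + y + x = D + E + x + y := by ring
    have := num_neg_of_pos (α := β) (β := α) hE hD (by linarith)
      (by linarith) hy hx (by rw [e]; exact hp)
    rw [e] at this
    linarith
  have hT : 0 < D + E + x + y := by linarith
  have hsum : (α * (D + E + x + y) - (D + x)) + (β * (D + E + x + y) - (E + y)) < 0 := by
    nlinarith [mul_pos (sub_pos.2 hs) hT]
  have hA' : x * (α * (D + E + x + y) - (D + x)) * (E + y) ≤ 0 :=
    mul_nonpos_of_nonpos_of_nonneg (mul_nonpos_of_nonneg_of_nonpos hx hA) (by linarith)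
  have hB' : y * (β * (D + E + x + y) - (E + y)) * (D + x) ≤ 0 :=
    mul_nonpos_of_nonpos_of_nonneg (mul_nonpos_of_nonneg_of_nonpos hy hB) (by linarith)
  have key : (0 < x ∧ α * (D + E + x + y) - (D + x) < 0) ∨
      (0 < y ∧ β * (D + E + x + y) - (E + y) < 0) := by
    rcases hx.eq_or_lt with rfl | hx0
    · right
      exact ⟨by linarith, by nlinarith⟩
    rcases hy.eq_or_lt with rfl | hy0
    · left
      exact ⟨hx0, by nlinarith⟩
    by_contra! hc
    linarith [hc.1 hx0, hc.2 hy0]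
  rcases key with ⟨hx0, hl⟩ | ⟨hy0, hl⟩
  · have := mul_neg_of_neg_of_pos (mul_neg_of_pos_of_neg hx0 hl) (by linarith : 0 < E + y)
    linarith
  · have := mul_neg_of_neg_of_pos (mul_neg_of_pos_of_neg hy0 hl) (by linarith : 0 < D + x)
    linarith

lemma payoff_neg {α β D E x y : ℝ} (hD : 0 < D) (hE : 0 < E) (hs : α + β < 1)
    (hα : 0 ≤ α) (hβ : 0 ≤ β)
    (h1 : α * (D + E) ≤ D) (h2 : β * (D + E) ≤ E) (hx : 0 ≤ x) (hy : 0 ≤ y)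
    (hxy : 0 < x + y) :
    x * (α * (D + E + x + y) / (D + x) - 1) + y * (β * (D + E + x + y) / (E + y) - 1) < 0 := by
  have hX : 0 < D + x := by linarith
  have hY : 0 < E + y := by linarith
  have e : x * (α * (D + E + x + y) / (D + x) - 1) + y * (β * (D + E + x + y) / (E + y) - 1)
      = (x * (α * (D + E + x + y) - (D + x)) * (E + y)
      + y * (β * (D + E + x + y) - (E + y)) * (D + x)) / ((D + x) * (E + y)) := by
    field_simp
  rw [e]
  exact div_neg_of_neg_of_pos (num_neg hD hE hs hα hβ h1 h2 hx hy hxy) (mul_pos hX hY)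

/-- Proposition 2(iii): the atomic player optimally abstains from betting. -/
theorem stmt_3 (κ q w : ℝ) (hκ : κ ∈ Ioo (0:ℝ) 1) (hq : q ∈ Icc (0:ℝ) 1) (hw : 0 < w)
    (μ : Measure ℝ) (hμ : NiceDensity μ)
    (f : ℝ → ℝ × ℝ) (a : ℝ × ℝ) (hf : FeasibleDiffuse f) (ha : FeasibleAtomic w a)
    (hd1 : 0 < d1 μ f) (hd2 : 0 < d2 μ f)
    (hq1 : q ≤ d1 μ f / (κ * (d1 μ f + d2 μ f)))
    (hq2 : 1 - q ≤ d2 μ f / (κ * (d1 μ f + d2 μ f))) :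
    (a.1 * (κ * q / impliedProb μ f a - 1) +
        a.2 * (κ * (1 - q) / (1 - impliedProb μ f a) - 1) =
      sSup {x | ∃ b1 b2 : ℝ, 0 ≤ b1 ∧ 0 ≤ b2 ∧ b1 + b2 ≤ w ∧
        x = b1 * (κ * q * (d1 μ f + d2 μ f + b1 + b2) / (d1 μ f + b1) - 1) +
          b2 * (κ * (1 - q) * (d1 μ f + d2 μ f + b1 + b2) / (d2 μ f + b2) - 1)})
    ↔ (a.1 = 0 ∧ a.2 = 0) := by
  obtain ⟨hκ0, hκ1⟩ := hκ
  obtain ⟨hq0, hq1'⟩ := hq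
  obtain ⟨ha1, ha2, haw⟩ := ha
  unfold impliedProb
  generalize d1 μ f = D at *
  generalize d2 μ f = E at *
  obtain ⟨x, y⟩ := a
  simp only at *
  have hκS : 0 < κ * (D + E) := by positivity
  rw [le_div_iff₀ hκS] at hq1 hq2
  have hα : 0 ≤ κ * q := by positivity
  have hβ : 0 ≤ κ * (1 - q) := mul_nonneg hκ0.le (by linarith)
  have hs : κ * q + κ * (1 - q) < 1 := by linarith
  have h1 : κ * q * (D + E) ≤ D := by linarith
  have h2 : κ * (1 - q) * (D + E) ≤ E := by linarith
  have hsup : sSup {x | ∃ b1 b2 : ℝ, 0 ≤ b1 ∧ 0 ≤ b2 ∧ b1 + b2 ≤ w ∧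
        x = b1 * (κ * q * (D + E + b1 + b2) / (D + b1) - 1) +
          b2 * (κ * (1 - q) * (D + E + b1 + b2) / (E + b2) - 1)} = 0 := by
    apply IsGreatest.csSup_eq
    refine ⟨⟨0, 0, le_rfl, le_rfl, by linarith, by simp⟩, ?_⟩
    rintro z ⟨b1, b2, hb1, hb2, -, rfl⟩
    rcases (add_nonneg hb1 hb2).eq_or_lt with h | h
    · obtain rfl : b1 = 0 := by linarith
      obtain rfl : b2 = 0 := by linarith
      simp
    · exact (payoff_neg hd1 hd2 hs hα hβ h1 h2 hb1 hb2 h).le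
  rw [hsup]
  constructor
  · intro h
    rcases (add_nonneg ha1 ha2).eq_or_lt with h0 | h0
    · exact ⟨by linarith, by linarith⟩
    · exfalso
      have hn := payoff_neg hd1 hd2 hs hα hβ h1 h2 ha1 ha2 h0
      have hT : D + E + x + y ≠ 0 := by positivity
      have e : 1 - (D + x) / (D + E + x + y) = (E + y) / (D + E + x + y) := by
        field_simp
        ring
      rw [e, div_div_eq_mul_div, div_div_eq_mul_div] at h
      linarith
  · rintro ⟨rfl, rfl⟩
    simp
end
end
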